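/- There do not exist five points p₁,…,p₅ in ℝ³, no four of which lie on a common affine plane, such that for every pair of indices i ≠ j there exist a nonzero linear functional f on ℝ³ and a real number c with f(pᵢ) = f(pⱼ) = c and f(p_k) > c for every k ∉ {i, j}. (Equivalently: it is impossible that all ten segments joining two of the five points are edges of their convex hull.) -/

import Mathlib

noncomputable section

local notation "E3" => EuclideanSpace ℝ (Fin 3)

theorem aux_cover (w : Fin 5 → ℝ) (h : (Finset.univ.filter fun k => 0 < w k).card ≤ 2) :
    ∃ i j : Fin 5, i ≠ j ∧ ∀ k, k ≠ i → k ≠ j → w k ≤ 0 := by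
  obtain ⟨t, ht, hc⟩ := Finset.exists_superset_card_eq h (by simp)
  obtain ⟨i, j, hij, rfl⟩ := Finset.card_eq_two.1 hc
  refine ⟨i, j, hij, fun k hi hj => ?_⟩
  by_contra hk
  have := ht (Finset.mem_filter.2 ⟨Finset.mem_univ k, not_le.1 hk⟩)
  simp [hi, hj] at this

theorem aux_zero (p : Fin 5 → E3)
    (H : ∀ i j : Fin 5, i ≠ j →
        ∃ (f : E3 →L[ℝ] ℝ) (c : ℝ), f ≠ 0 ∧
          f (p i) = c ∧ f (p j) = c ∧
          ∀ k : Fin 5, k ≠ i → k ≠ j → c < f (p k))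
    (w : Fin 5 → ℝ) (h0 : ∑ k, w k = 0) (h1 : ∑ k, w k • p k = 0)
    (h : (Finset.univ.filter fun k => 0 < w k).card ≤ 2) : ∀ k, w k = 0 := by
  have key : ∀ (f : E3 →L[ℝ] ℝ) (c : ℝ), ∑ k, w k * (f (p k) - c) = 0 := by
    intro f c
    have h2 : ∑ k, w k * f (p k) = 0 := by
      have := congrArg f h1
      simpa [map_sum] using this
    simp only [mul_sub, Finset.sum_sub_distrib, ← Finset.sum_mul, h0, h2]
    simp
  obtain ⟨i, j, hij, hw⟩ := aux_cover w h
  have hz : ∀ k, k ≠ i → k ≠ j → w k = 0 := by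
    obtain ⟨f, c, -, hi, hj, hk⟩ := H i j hij
    have hn : ∀ k ∈ Finset.univ, w k * (f (p k) - c) ≤ 0 := by
      intro k _
      by_cases a : k = i
      · simp [a, hi]
      by_cases b : k = j
      · simp [b, hj]
      exact mul_nonpos_of_nonpos_of_nonneg (hw k a b) (sub_pos.2 (hk k a b)).le
    intro k a b
    have := (Finset.sum_eq_zero_iff_of_nonpos hn).1 (key f c) k (Finset.mem_univ k)
    rcases mul_eq_zero.1 this with h | h
    · exact h
    · linarith [hk k a b]
  have hj0 : w j = 0 := by
    obtain ⟨l, hli, hlj⟩ : ∃ l : Fin 5, l ≠ i ∧ l ≠ j := by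
      clear * -
      revert i j
      decide
    obtain ⟨f, c, -, hi, hl, hk⟩ := H i l hli.symm
    have hs := key f c
    rw [Finset.sum_eq_single j ?_ (by simp)] at hs
    · rcases mul_eq_zero.1 hs with h | h
      · exact h
      · linarith [hk j hij.symm hlj.symm]
    · intro b _ hb
      by_cases a : b = i
      · simp [a, hi]
      · simp [hz b a hb]
  have hi0 : w i = 0 := by
    rw [Finset.sum_eq_single i ?_ (by simp)] at h0
    · exact h0
    · intro b _ hb
      by_cases a : b = j
      · simp [a, hj0]
      · exact hz b hb a
  intro k
  by_cases a : k = i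
  · rw [a, hi0]
  by_cases b : k = j
  · rw [b, hj0]
  exact hz k a b

/-- There do not exist five points of `ℝ³`, no four of which are coplanar, such
that every segment joining two of them is an edge of their convex hull (i.e.,
for every pair `i ≠ j` there is a nonzero linear functional attaining the value
`c` exactly at `pᵢ, pⱼ` and being `> c` at the other three points). -/
theorem no_five_points_all_segments_edges :
    ¬ ∃ p : Fin 5 → E3,
      (∀ i j k l : Fin 5, i ≠ j → i ≠ k → i ≠ l → j ≠ k → j ≠ l → k ≠ l →
        ¬ Coplanar ℝ ({p i, p j, p k, p l} : Set E3)) ∧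
      (∀ i j : Fin 5, i ≠ j →
        ∃ (f : E3 →L[ℝ] ℝ) (c : ℝ), f ≠ 0 ∧
          f (p i) = c ∧ f (p j) = c ∧
          ∀ k : Fin 5, k ≠ i → k ≠ j → c < f (p k)) := by
  rintro ⟨p, -, H⟩
  have hd : ¬ LinearIndependent ℝ (fun k => ((p k, 1) : E3 × ℝ)) := by
    intro h
    have := h.fintype_card_le_finrank
    simp at this
  obtain ⟨w, hw, k, hk⟩ := Fintype.not_linearIndependent_iff.1 hd
  have h1 : ∑ k, w k • p k = 0 := by
    simpa [Prod.fst_sum] using congrArg Prod.fst hw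
  have h0 : ∑ k, w k = 0 := by
    simpa [Prod.snd_sum] using congrArg Prod.snd hw
  have hdis : Disjoint (Finset.univ.filter fun k => 0 < w k)
      (Finset.univ.filter fun k => 0 < (-w) k) := by
    rw [Finset.disjoint_filter]
    intro x _ hx hy
    simp at hy
    linarith
  have hc := Finset.card_le_univ ((Finset.univ.filter fun k => 0 < w k) ∪
      (Finset.univ.filter fun k => 0 < (-w) k))
  rw [Finset.card_union_of_disjoint hdis, Fintype.card_fin] at hc
  by_cases h : (Finset.univ.filter fun k => 0 < w k).card ≤ 2
  · exact hk (aux_zero p H w h0 h1 h k)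
  · have := aux_zero p H (-w) (by simp [h0]) (by simp [h1]) (by omega) k
    exact hk (by simpa using this)

end
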